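/- Let R be a reduced local hypersurface of dimension 1 and M, N maximal Cohen-Macaulay R-modules. Then Ext_R^1(M, N) = 0 if and only if Tor_2^R(M^t, N) = 0, where M^t denotes the Auslander transpose of M (the cokernel of the dual of the first map in a minimal free resolution of M). -/

import Mathlib

open CategoryTheory Opposite IsLocalRing

noncomputable abbrev ExtGroup (R : Type) [CommRing R] (i : ℕ)
    (M N : Type) [AddCommGroup M] [Module R M] [AddCommGroup N] [Module R N] : Type :=
  ((Ext R (ModuleCat R) i).obj (op (ModuleCat.of R M))).obj (ModuleCat.of R N)

noncomputable abbrev TorGroup (R : Type) [CommRing R] (i : ℕ)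
    (M N : Type) [AddCommGroup M] [Module R M] [AddCommGroup N] [Module R N] : Type :=
  ((Tor (ModuleCat R) i).obj (ModuleCat.of R M)).obj (ModuleCat.of R N)

noncomputable def moduleDepth (R : Type) [CommRing R] [IsLocalRing R]
    (M : Type) [AddCommGroup M] [Module R M] : ℕ∞ :=
  sInf {i : ℕ∞ | ∃ n : ℕ, i = n ∧ Nontrivial (ExtGroup R n (ResidueField R) M)}

def IsRegularLocalTwoDim (S : Type) [CommRing S] [IsLocalRing S] : Prop :=
  IsNoetherianRing S ∧ ringKrullDim S = 2 ∧
    ∃ x y : S, IsLocalRing.maximalIdeal S = Ideal.span {x, y}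

def IsMCM1 (R : Type) [CommRing R] [IsLocalRing R]
    (M : Type) [AddCommGroup M] [Module R M] : Prop :=
  Module.Finite R M ∧ moduleDepth R M = 1


theorem exists_unit_mul_pow {T : Type*} [CommRing T] [IsLocalRing T] [IsNoetherianRing T]
    (y : T) (hy : maximalIdeal T = Ideal.span {y}) (a : T) (ha : a ≠ 0) :
    ∃ (k : ℕ) (u : T), IsUnit u ∧ a = u * y ^ k := by
  classical
  have hex : ∃ k, a ∉ (Ideal.span {y} : Ideal T) ^ k := by
    by_contra! h
    have h1 : a ∈ (⨅ i : ℕ, (Ideal.span {y} : Ideal T) ^ i) := by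
      simpa [Submodule.mem_iInf] using h
    rw [Ideal.iInf_pow_eq_bot_of_isLocalRing _ (by rw [← hy]; exact (maximalIdeal.isMaximal T).ne_top)] at h1
    exact ha (by simpa using h1)
  have hk := Nat.find_spec hex
  have hk0 : Nat.find hex ≠ 0 := by
    intro h0
    rw [h0] at hk
    simp at hk
  obtain ⟨k, hkk⟩ := Nat.exists_eq_succ_of_ne_zero hk0
  have h2 : a ∈ (Ideal.span {y} : Ideal T) ^ k := by
    have := Nat.find_min hex (m := k) (by omega)
    simpa using this
  rw [hkk] at hk
  rw [Ideal.span_singleton_pow, Ideal.mem_span_singleton] at h2 hk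
  obtain ⟨u, rfl⟩ := h2
  refine ⟨k, u, ?_, mul_comm _ _⟩
  by_contra hu
  have : u ∈ maximalIdeal T := hu
  rw [hy, Ideal.mem_span_singleton] at this
  obtain ⟨v, rfl⟩ := this
  exact hk ⟨v, by rw [pow_succ]; ring⟩

theorem isDomain_of_principal {T : Type*} [CommRing T] [IsLocalRing T] [IsNoetherianRing T]
    (y : T) (hy : maximalIdeal T = Ideal.span {y}) (hnil : ¬ IsNilpotent y) : IsDomain T := by
  have : NoZeroDivisors T := by
    constructor
    intro a b hab
    by_contra! h
    obtain ⟨k, u, hu, rfl⟩ := exists_unit_mul_pow y hy a h.1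
    obtain ⟨l, v, hv, rfl⟩ := exists_unit_mul_pow y hy b h.2
    apply hnil
    refine ⟨k + l, ?_⟩
    have h3 : (u * v) * y ^ (k + l) = 0 := by rw [← hab]; ring
    exact (hu.mul hv).mul_right_eq_zero.mp h3
  exact NoZeroDivisors.to_isDomain T

theorem isPIR_of_principal {T : Type*} [CommRing T] [IsLocalRing T] [IsNoetherianRing T] [IsDomain T]
    (y : T) (hy : maximalIdeal T = Ideal.span {y}) : IsPrincipalIdealRing T := by
  have h := (tfae_of_isNoetherianRing_of_isLocalRing_of_isDomain (R := T)).out 0 4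
  exact h.mpr ⟨y, hy⟩

open Ideal in
theorem dim_le_one_of_principal {T : Type*} [CommRing T] [IsLocalRing T] [IsNoetherianRing T]
    (y : T) (hy : maximalIdeal T = Ideal.span {y}) : ringKrullDim T ≤ 1 := by
  refine (ringKrullDim_le_spanFinrank_maximalIdeal T).trans ?_
  rw [hy]
  exact_mod_cast (Submodule.spanFinrank_span_le_ncard_of_finite (Set.finite_singleton y)).trans (by simp)

theorem maximalIdeal_quot {S : Type*} [CommRing S] [IsLocalRing S] (I : Ideal S) [IsLocalRing (S ⧸ I)] :
    maximalIdeal (S ⧸ I) = (maximalIdeal S).map (Ideal.Quotient.mk I) := by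
  have := IsLocalRing.map_maximalIdeal_of_surjective  (Ideal.Quotient.mk I) Ideal.Quotient.mk_surjective
  exact this.symm


theorem pow_not_mem_of_dim {T : Type*} [CommRing T] [IsLocalRing T] [IsNoetherianRing T]
    (hdim : ¬ ringKrullDim T ≤ 1) (x y : T) (hxy : maximalIdeal T = Ideal.span {x, y}) (k : ℕ) :
    y ^ k ∉ Ideal.span {x} := by
  intro hk
  apply hdim
  have hmin : maximalIdeal T ∈ (Ideal.span {x}).minimalPrimes := by
    refine ⟨⟨inferInstance, ?_⟩, ?_⟩
    · rw [hxy]; exact Ideal.span_mono (by simp)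
    · rintro p ⟨hp, hxp⟩ -
      rw [hxy, Ideal.span_le]
      have hyp : y ∈ p := hp.mem_of_pow_mem k (hxp hk)
      have hxp' : x ∈ p := hxp (Ideal.mem_span_singleton_self x)
      intro z hz
      rcases hz with rfl | rfl
      · exact hxp'
      · exact hyp
  have := Ideal.height_le_one_of_isPrincipal_of_mem_minimalPrimes _ _ hmin
  rw [← IsLocalRing.maximalIdeal_height_eq_ringKrullDim]
  exact_mod_cast this

theorem maximalIdeal_quot_pair {S : Type*} [CommRing S] [IsLocalRing S] (I : Ideal S)
    [IsLocalRing (S ⧸ I)] (x y : S) (hxy : maximalIdeal S = Ideal.span {x, y}) :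
    maximalIdeal (S ⧸ I) = Ideal.span {Ideal.Quotient.mk I x, Ideal.Quotient.mk I y} := by
  rw [maximalIdeal_quot, hxy, Ideal.map_span, Set.image_pair]

theorem maximalIdeal_quot_single {S : Type*} [CommRing S] [IsLocalRing S] (I : Ideal S)
    [IsLocalRing (S ⧸ I)] (x y : S) (hxy : maximalIdeal S = Ideal.span {x, y}) (hx : x ∈ I) :
    maximalIdeal (S ⧸ I) = Ideal.span {Ideal.Quotient.mk I y} := by
  rw [maximalIdeal_quot_pair I x y hxy, Ideal.Quotient.eq_zero_iff_mem.mpr hx]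
  simp [Ideal.span_insert]

theorem regular_key {S : Type*} [CommRing S] [IsLocalRing S] [IsNoetherianRing S]
    (hdim : ringKrullDim S = 2) (x y : S) (hxy : maximalIdeal S = Ideal.span {x, y}) :
    IsDomain S ∧ (Ideal.span {x}).IsPrime ∧ x ≠ 0 ∧ y ∉ Ideal.span {x} := by
  have h2 : ((2 : ℕ) : WithBot ℕ∞) ≤ Order.krullDim (PrimeSpectrum S) := by
    change _ ≤ ringKrullDim S
    rw [hdim]; rfl
  obtain ⟨l, hl⟩ := Order.le_krullDim_iff.mp h2
  have h01 : l.toFun ⟨0, by omega⟩ < l.toFun ⟨1, by omega⟩ := l.strictMono (by simp [Fin.lt_def])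
  have h12 : l.toFun ⟨1, by omega⟩ < l.toFun ⟨2, by omega⟩ := l.strictMono (by simp)
  generalize l.toFun ⟨0, by omega⟩ = p0 at *
  generalize l.toFun ⟨1, by omega⟩ = p1 at *
  generalize l.toFun ⟨2, by omega⟩ = p2 at *
  let q := p0.asIdeal
  have hq : q.IsPrime := p0.isPrime
  have hTdim : ¬ ringKrullDim (S ⧸ q) ≤ 1 := by
    rw [ringKrullDim_quotient]
    intro hle
    have hmem : ∀ p : PrimeSpectrum S, p0 ≤ p → p ∈ PrimeSpectrum.zeroLocus (q : Set S) := fun p hp => hp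
    let s : LTSeries (PrimeSpectrum.zeroLocus (q : Set S)) :=
      RelSeries.fromListIsChain [⟨p0, hmem _ le_rfl⟩, ⟨p1, hmem _ h01.le⟩, ⟨p2, hmem _ (h01.trans h12).le⟩]
        (by simp) (by
          simp only [List.isChain_cons_cons, List.IsChain.singleton, and_true]
          exact ⟨h01, h12⟩)
    have := Order.LTSeries.length_le_krullDim s
    have h3 := this.trans hle
    have h4 : s.length = 2 := rfl
    rw [h4] at h3
    exact absurd h3 (by decide)
  have hxm : Ideal.span {x} ≤ maximalIdeal S := by
    rw [hxy]; exact Ideal.span_mono (by simp)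
  have hloc : IsLocalRing (S ⧸ q) :=
    IsLocalRing.of_surjective' (Ideal.Quotient.mk _) Ideal.Quotient.mk_surjective
  have : Nontrivial (S ⧸ Ideal.span {x}) :=
    Ideal.Quotient.nontrivial_iff.mpr (fun h => (maximalIdeal.isMaximal S).ne_top (top_le_iff.mp (h ▸ hxm)))
  have hlocx : IsLocalRing (S ⧸ Ideal.span {x}) :=
    IsLocalRing.of_surjective' (Ideal.Quotient.mk _) Ideal.Quotient.mk_surjective
  have hk := pow_not_mem_of_dim hTdim _ _ (maximalIdeal_quot_pair q x y hxy)
  have hk' : ∀ k, y ^ k ∉ q ⊔ Ideal.span {x} := by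
    intro k hmem
    apply hk k
    have := Ideal.mem_map_of_mem (Ideal.Quotient.mk q) hmem
    rw [Ideal.map_sup, Ideal.map_quotient_self, bot_sup_eq, Ideal.map_span, Set.image_singleton, map_pow] at this
    exact this
  have hmx := maximalIdeal_quot_single (Ideal.span {x}) x y hxy (Ideal.mem_span_singleton_self x)
  have hdx : IsDomain (S ⧸ Ideal.span {x}) := by
    apply isDomain_of_principal _ hmx
    rintro ⟨k, hk2⟩
    rw [← map_pow, Ideal.Quotient.eq_zero_iff_mem] at hk2
    exact hk' k (Ideal.mem_sup_right hk2)
  have hpx : (Ideal.span {x}).IsPrime := (Ideal.Quotient.isDomain_iff_prime _).mp hdx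
  have hqx : q ≤ Ideal.span {x} := by
    intro a ha
    by_contra hax
    obtain ⟨k, u, hu, hau⟩ := exists_unit_mul_pow _ hmx (Ideal.Quotient.mk _ a)
      (fun h => hax (Ideal.Quotient.eq_zero_iff_mem.mp h))
    obtain ⟨v, hv⟩ := hu.exists_right_inv
    obtain ⟨v, rfl⟩ := Ideal.Quotient.mk_surjective v
    have h5 : Ideal.Quotient.mk (Ideal.span {x}) (y ^ k) = Ideal.Quotient.mk _ (v * a) := by
      rw [map_mul, hau, map_pow, ← mul_assoc, mul_comm _ u, hv, one_mul]
    rw [Ideal.Quotient.mk_eq_mk_iff_sub_mem] at h5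
    apply hk' k
    have h6 : y ^ k = v * a + (y ^ k - v * a) := by ring
    rw [h6]
    exact Ideal.add_mem _ (Ideal.mem_sup_left (q.mul_mem_left v ha)) (Ideal.mem_sup_right h5)
  have hxq : x ∉ q := by
    intro hx
    exact hTdim (dim_le_one_of_principal _ (maximalIdeal_quot_single q x y hxy hx))
  have hq0 : q = ⊥ := by
    apply Submodule.eq_bot_of_le_smul_of_le_jacobson_bot (Ideal.span {x}) q (IsNoetherian.noetherian q)
    · intro a ha
      obtain ⟨b, rfl⟩ := Ideal.mem_span_singleton.mp (hqx ha)
      have hb : b ∈ q := (hq.mem_or_mem ha).resolve_left hxq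
      exact Submodule.smul_mem_smul (Ideal.mem_span_singleton_self x) hb
    · rw [IsLocalRing.jacobson_eq_maximalIdeal _ bot_ne_top]
      exact hxm
  rw [hq0] at hq hxq
  refine ⟨IsDomain.of_bot_isPrime S, hpx, fun h => hxq (by simp [h]), fun h => hk' 1 ?_⟩
  rw [pow_one]
  exact Ideal.mem_sup_right h

open Pointwise in
theorem free_of_socle {S : Type*} [CommRing S] [IsLocalRing S] [IsNoetherianRing S] [IsDomain S]
    (x y : S) (hxy : maximalIdeal S = Ideal.span {x, y}) (hpx : (Ideal.span {x}).IsPrime)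
    (hx0 : x ≠ 0) (hyx : y ∉ Ideal.span {x}) (n : ℕ) (K : Submodule S (Fin n → S))
    (hK : ∀ s, x • s ∈ K → y • s ∈ K → s ∈ K) : Module.Free S K := by
  have hxm : x ∈ maximalIdeal S := by
    rw [hxy]; exact Ideal.subset_span (by simp)
  have reg : IsSMulRegular K x := by
    intro a b hab
    exact smul_right_injective _ hx0 hab
  have : Module.FinitePresentation S K := Module.finitePresentation_of_finite S K
  rw [← Module.free_quotSMulTop_iff_free S K (x := x) ?_ reg]
  swap
  · rw [IsLocalRing.jacobson_eq_maximalIdeal _ bot_ne_top]; exact hxm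
  have hdx : IsDomain (S ⧸ Ideal.span {x}) := (Ideal.Quotient.isDomain_iff_prime _).mpr hpx
  have hlocx : IsLocalRing (S ⧸ Ideal.span {x}) :=
    IsLocalRing.of_surjective' (Ideal.Quotient.mk _) Ideal.Quotient.mk_surjective
  have hmx := maximalIdeal_quot_single (Ideal.span {x}) x y hxy (Ideal.mem_span_singleton_self x)
  have := isPIR_of_principal _ hmx
  have : Module.Finite (S ⧸ Ideal.span {x}) (QuotSMulTop x K) :=
    Module.Finite.of_restrictScalars_finite S (S ⧸ Ideal.span {x}) (QuotSMulTop x K)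
  have hyreg : ∀ k : QuotSMulTop x K, Ideal.Quotient.mk (Ideal.span {x}) y • k = 0 → k = 0 := by
    intro k hk
    obtain ⟨k, rfl⟩ := Submodule.Quotient.mk_surjective _ k
    have h1 : y • k ∈ (x • (⊤ : Submodule S K)) := by
      rw [← Submodule.Quotient.mk_eq_zero]
      exact hk
    rw [Submodule.Quotient.mk_eq_zero]
    obtain ⟨k', -, hk'⟩ := (Submodule.mem_smul_pointwise_iff_exists _ _ _).mp h1
    have h2 : ∀ i, ∃ s, (k : Fin n → S) i = x * s := by
      intro i
      have h3 : x * (k' : Fin n → S) i = y * (k : Fin n → S) i :=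
        congrFun (congrArg Subtype.val hk') i
      have h4 : y * (k : Fin n → S) i ∈ Ideal.span {x} := Ideal.mem_span_singleton.mpr ⟨_, h3.symm⟩
      exact Ideal.mem_span_singleton.mp ((hpx.mem_or_mem h4).resolve_left hyx)
    choose s hs using h2
    have hs1 : (k : Fin n → S) = x • s := by ext i; simp [hs i]
    have hs2 : (k' : Fin n → S) = y • s := by
      apply smul_right_injective _ hx0
      change x • (k' : Fin n → S) = x • (y • s)
      rw [smul_comm, ← hs1]
      exact congrArg Subtype.val hk'
    have hsK : s ∈ K := hK s (hs1 ▸ k.2) (hs2 ▸ k'.2)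
    refine (Submodule.mem_smul_pointwise_iff_exists _ _ _).mpr ⟨⟨s, hsK⟩, trivial, ?_⟩
    ext1
    exact hs1.symm
  have hyreg' : ∀ (j : ℕ) (k : QuotSMulTop x K), (Ideal.Quotient.mk (Ideal.span {x}) y) ^ j • k = 0 → k = 0 := by
    intro j
    induction j with
    | zero => intro k hk; simpa using hk
    | succ j ih =>
      intro k hk
      rw [pow_succ, mul_smul] at hk
      exact hyreg _ (ih _ hk)
  have : Module.IsTorsionFree (S ⧸ Ideal.span {x}) (QuotSMulTop x K) := by
    apply Module.IsTorsionFree.of_smul_eq_zero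
    intro a k hak
    by_cases ha : a = 0
    · exact Or.inl ha
    · right
      obtain ⟨j, u, hu, rfl⟩ := exists_unit_mul_pow _ hmx a ha
      rw [mul_smul, hu.smul_eq_zero] at hak
      exact hyreg' _ _ hak
  exact Module.free_of_finite_type_torsion_free'


theorem exact_of_factorization {S : Type*} [CommRing S] [IsDomain S] (f : S) (hf0 : f ≠ 0)
    {n r : ℕ} (A : Matrix (Fin n) (Fin r) S) (B : Matrix (Fin r) (Fin n) S)
    (hAB : A * B = f • 1) (hBA : B * A = f • 1) :
    Function.Exact (A.map (Ideal.Quotient.mk (Ideal.span {f}))).mulVecLin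
      (B.map (Ideal.Quotient.mk (Ideal.span {f}))).mulVecLin := by
  set q := Ideal.Quotient.mk (Ideal.span {f}) with hq
  have hqf : q f = 0 := Ideal.Quotient.eq_zero_iff_mem.mpr (Ideal.mem_span_singleton_self f)
  have hlift : ∀ {m : ℕ} (v : Fin m → S ⧸ Ideal.span {f}), ∃ w : Fin m → S, v = q ∘ w := by
    intro m v
    choose w hw using fun i => Ideal.Quotient.mk_surjective (v i)
    exact ⟨w, funext fun i => (hw i).symm⟩
  have hmap : ∀ {m l : ℕ} (C : Matrix (Fin m) (Fin l) S) (w : Fin l → S),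
      (C.map q).mulVec (q ∘ w) = q ∘ (C.mulVec w) := by
    intro m l C w
    ext i
    exact (RingHom.map_mulVec q C w i).symm
  intro v
  obtain ⟨w, rfl⟩ := hlift v
  simp only [Matrix.mulVecLin_apply, Set.mem_range]
  constructor
  · intro h
    rw [hmap] at h
    have h1 : ∀ i, ∃ t, B.mulVec w i = f * t := fun i =>
      Ideal.mem_span_singleton.mp (Ideal.Quotient.eq_zero_iff_mem.mp (congrFun h i))
    choose t ht using h1
    have ht' : B.mulVec w = f • t := by ext i; simp [ht]
    refine ⟨q ∘ t, ?_⟩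
    rw [hmap]
    congr 1
    apply smul_right_injective _ hf0
    change f • _ = f • w
    rw [← Matrix.mulVec_smul, ← ht', Matrix.mulVec_mulVec, hAB, Matrix.smul_mulVec, Matrix.one_mulVec]
  · rintro ⟨u, hu⟩
    obtain ⟨u, rfl⟩ := hlift u
    rw [← hu, hmap, hmap, Matrix.mulVec_mulVec, hBA, Matrix.smul_mulVec, Matrix.one_mulVec]
    ext i
    simp [hqf]

theorem exists_factorization {S : Type} [CommRing S] [IsLocalRing S] [IsNoetherianRing S]
    (hdim : ringKrullDim S = 2) (x y : S) (hxy : maximalIdeal S = Ideal.span {x, y})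
    (f : S) (hf0 : f ≠ 0) [IsLocalRing (S ⧸ Ideal.span {f})]
    (M : Type) [AddCommGroup M] [Module (S ⧸ Ideal.span {f}) M]
    [Module.Finite (S ⧸ Ideal.span {f}) M]
    (hsoc : ∀ m : M, (∀ r ∈ maximalIdeal (S ⧸ Ideal.span {f}), r • m = 0) → m = 0) :
    ∃ (n r : ℕ) (A : Matrix (Fin n) (Fin r) (S ⧸ Ideal.span {f}))
      (B : Matrix (Fin r) (Fin n) (S ⧸ Ideal.span {f}))
      (p : (Fin n → (S ⧸ Ideal.span {f})) →ₗ[S ⧸ Ideal.span {f}] M),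
      Function.Surjective p ∧ Function.Exact A.mulVecLin p ∧
      Function.Exact B.mulVecLin A.mulVecLin ∧
      Function.Exact B.transpose.mulVecLin A.transpose.mulVecLin ∧
      Function.Exact A.transpose.mulVecLin B.transpose.mulVecLin := by
  obtain ⟨hdom, hpx, hx0, hyx⟩ := regular_key hdim x y hxy
  obtain ⟨n, p, hp⟩ := Module.Finite.exists_fin' (S ⧸ Ideal.span {f}) M
  set q := Ideal.Quotient.mk (Ideal.span {f}) with hq
  have hqf : q f = 0 := Ideal.Quotient.eq_zero_iff_mem.mpr (Ideal.mem_span_singleton_self f)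
  have hcs : ∀ (c : S) (a : Fin n → S), q ∘ (c • a) = q c • (q ∘ a) := by
    intro c a; ext i; simp
  let K : Submodule S (Fin n → S) :=
    { carrier := {s | p (q ∘ s) = 0}
      add_mem' := by
        intro a b ha hb
        have : q ∘ (a + b) = q ∘ a + q ∘ b := by ext i; simp
        simp only [Set.mem_ofPred_eq] at *
        rw [this, map_add, ha, hb, add_zero]
      zero_mem' := by
        have : q ∘ (0 : Fin n → S) = 0 := by ext i; simp
        simp only [Set.mem_ofPred_eq]
        rw [this, map_zero]
      smul_mem' := by
        intro c a ha
        simp only [Set.mem_ofPred_eq] at *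
        rw [hcs, map_smul, ha, smul_zero] }
  have hKmem : ∀ s, s ∈ K ↔ p (q ∘ s) = 0 := fun s => Iff.rfl
  have hmR := maximalIdeal_quot_pair (Ideal.span {f}) x y hxy
  have hfree : Module.Free S K := by
    apply free_of_socle x y hxy hpx hx0 hyx
    intro s hs1 hs2
    rw [hKmem, hcs, map_smul] at hs1 hs2
    rw [hKmem]
    apply hsoc
    intro r hr
    rw [hmR, Ideal.mem_span_pair] at hr
    obtain ⟨a, b, rfl⟩ := hr
    rw [add_smul, mul_smul, mul_smul, hs1, hs2, smul_zero, smul_zero, add_zero]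
  let bas := Module.finBasis S K
  set r := Module.finrank S K
  let φ : (Fin r → S) →ₗ[S] (Fin n → S) := K.subtype ∘ₗ bas.equivFun.symm.toLinearMap
  have hφinj : Function.Injective φ := K.injective_subtype.comp bas.equivFun.symm.injective
  have hφr : ∀ s, s ∈ K ↔ ∃ t, φ t = s := by
    intro s
    constructor
    · intro hs
      exact ⟨bas.equivFun ⟨s, hs⟩, by simp [φ]⟩
    · rintro ⟨t, rfl⟩
      exact (bas.equivFun.symm t).2
  have hfK : ∀ s, f • s ∈ K := by
    intro s
    rw [hKmem, hcs, hqf, zero_smul, map_zero]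
  let ψ : (Fin n → S) →ₗ[S] (Fin r → S) :=
    bas.equivFun.toLinearMap ∘ₗ (LinearMap.codRestrict K (f • LinearMap.id) hfK)
  have hφψ : φ ∘ₗ ψ = f • LinearMap.id := by
    ext1 i
    ext j
    simp [φ, ψ]
  have hψφ : ψ ∘ₗ φ = f • LinearMap.id := by
    apply LinearMap.ext
    intro t
    apply hφinj
    have := LinearMap.congr_fun hφψ (φ t)
    simpa using this
  have hAB : φ.toMatrix' * ψ.toMatrix' = f • 1 := by
    rw [← LinearMap.toMatrix'_comp, hφψ]; simp
  have hBA : ψ.toMatrix' * φ.toMatrix' = f • 1 := by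
    rw [← LinearMap.toMatrix'_comp, hψφ]; simp
  refine ⟨n, r, φ.toMatrix'.map q, ψ.toMatrix'.map q, p, hp, ?_,
    exact_of_factorization f hf0 _ _ hBA hAB, ?_, ?_⟩
  · intro v
    choose w hw using fun i => Ideal.Quotient.mk_surjective (v i)
    obtain rfl : q ∘ w = v := funext hw
    have hmap : ∀ (t : Fin r → S), (φ.toMatrix'.map q).mulVec (q ∘ t) = q ∘ (φ t) := by
      intro t
      ext i
      rw [← LinearMap.toMatrix'_mulVec]
      exact (RingHom.map_mulVec q _ t i).symm
    rw [← hKmem]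
    constructor
    · intro h
      obtain ⟨t, ht⟩ := (hφr _).mp h
      exact ⟨q ∘ t, by rw [Matrix.mulVecLin_apply, hmap, ht]⟩
    · rintro ⟨t, ht⟩
      choose t' ht' using fun i => Ideal.Quotient.mk_surjective (t i)
      obtain rfl : q ∘ t' = t := funext ht'
      rw [Matrix.mulVecLin_apply, hmap] at ht
      rw [hKmem, ← ht, ← hKmem, hφr]
      exact ⟨_, rfl⟩
  · have := exact_of_factorization f hf0 ψ.toMatrix'.transpose φ.toMatrix'.transpose
      (by rw [← Matrix.transpose_mul, hAB]; simp) (by rw [← Matrix.transpose_mul, hBA]; simp)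
    simpa only [Matrix.transpose_map] using this
  · have := exact_of_factorization f hf0 φ.toMatrix'.transpose ψ.toMatrix'.transpose
      (by rw [← Matrix.transpose_mul, hBA]; simp) (by rw [← Matrix.transpose_mul, hAB]; simp)
    simpa only [Matrix.transpose_map] using this

theorem subsingleton_iff_of_iso_homology {R : Type} [CommRing R] {ι : Type} {c : ComplexShape ι}
    (C : HomologicalComplex (ModuleCat.{0} R) c) (i j k : ι) (hi : c.prev j = i) (hk : c.next j = k)
    (X : ModuleCat.{0} R) (e : X ≅ C.homology j) :
    Subsingleton X ↔ Function.Exact (C.d i j).hom (C.d j k).hom := by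
  rw [← ModuleCat.isZero_iff_subsingleton, e.isZero_iff, ← HomologicalComplex.exactAt_iff_isZero_homology,
    HomologicalComplex.exactAt_iff' C i j k hi hk]
  exact ShortComplex.ShortExact.moduleCat_exact_iff_function_exact _

theorem exists_resolution_tor {R : Type} [CommRing R] (X N : Type) [AddCommGroup X] [Module R X]
    [AddCommGroup N] [Module R N] :
    ∃ (P0 P1 P2 P3 : ModuleCat.{0} R) (d3 : P3 →ₗ[R] P2) (d2 : P2 →ₗ[R] P1) (d1 : P1 →ₗ[R] P0)
      (e : P0 →ₗ[R] N), Module.Projective R P0 ∧ Module.Projective R P1 ∧ Module.Projective R P2 ∧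
      Function.Surjective e ∧ Function.Exact d1 e ∧ Function.Exact d2 d1 ∧ Function.Exact d3 d2 ∧
      (Subsingleton (TorGroup R 2 X N) ↔ Function.Exact (d3.lTensor X) (d2.lTensor X)) ∧
      (∀ Y : ModuleCat.{0} R, Subsingleton (ExtGroup R 1 N Y) ↔
        ∀ g : P1 →ₗ[R] Y, g ∘ₗ d2 = 0 → ∃ h : P0 →ₗ[R] Y, h ∘ₗ d1 = g) ∧
      (∀ Y : ModuleCat.{0} R, Subsingleton (ExtGroup R 0 N Y) → 
        ∀ g : P0 →ₗ[R] Y, g ∘ₗ d1 = 0 → g = 0) := by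
  let P := ProjectiveResolution.of (ModuleCat.of R N)
  have hex : ∀ n, Function.Exact (P.complex.d (n+2) (n+1)).hom (P.complex.d (n+1) n).hom := by
    intro n
    have := P.complex_exactAt_succ n
    rw [HomologicalComplex.exactAt_iff' _ (n+2) (n+1) n (by simp) (by simp)] at this
    exact (ShortComplex.ShortExact.moduleCat_exact_iff_function_exact _).mp this
  have hproj : ∀ n, Module.Projective R (P.complex.X n) := fun n =>
    (IsProjective.iff_projective (R := R) (P.complex.X n)).mpr (P.projective n)
  refine ⟨P.complex.X 0, P.complex.X 1, P.complex.X 2, P.complex.X 3, (P.complex.d 3 2).hom,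
    (P.complex.d 2 1).hom, (P.complex.d 1 0).hom, (P.π.f 0).hom, hproj 0, hproj 1, hproj 2, ?_, ?_,
    hex 0, hex 1, ?_, ?_, ?_⟩
  · exact (ModuleCat.epi_iff_surjective (P.π.f 0)).mp inferInstance
  · exact (ShortComplex.ShortExact.moduleCat_exact_iff_function_exact _).mp P.exact₀
  · exact subsingleton_iff_of_iso_homology _ 3 2 1 (by simp) (by simp) _
      (P.isoLeftDerivedObj ((MonoidalCategory.tensoringLeft (ModuleCat R)).obj (ModuleCat.of R X)) 2)
  · intro Y
    rw [subsingleton_iff_of_iso_homology _ 0 1 2 (by simp) (by simp) _ (P.isoExt 1 Y)]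
    constructor
    · intro h g hg
      obtain ⟨h', hh'⟩ := (h (ModuleCat.ofHom g)).mp (ModuleCat.hom_ext hg)
      exact ⟨h'.hom, congrArg ModuleCat.Hom.hom hh'⟩
    · intro h g
      constructor
      · intro hg
        obtain ⟨h', hh'⟩ := h g.hom (congrArg ModuleCat.Hom.hom hg)
        exact ⟨ModuleCat.ofHom h', ModuleCat.hom_ext hh'⟩
      · rintro ⟨h', rfl⟩
        have h1 : P.complex.d 2 1 ≫ P.complex.d 1 0 ≫ (show P.complex.X 0 ⟶ Y from h') = 0 := by
          rw [← Category.assoc, P.complex.d_comp_d, Limits.zero_comp]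
        exact h1
  · intro Y
    rw [subsingleton_iff_of_iso_homology _ 0 0 1 (by simp) (by simp) _ (P.isoExt 0 Y)]
    intro h g hg
    obtain ⟨h', hh'⟩ := (h (ModuleCat.ofHom g)).mp (ModuleCat.hom_ext hg)
    rw [HomologicalComplex.shape _ _ _ (by simp)] at hh'
    exact (congrArg ModuleCat.Hom.hom hh').symm

theorem socle_of_depth {R : Type} [CommRing R] [IsLocalRing R] (M : Type) [AddCommGroup M] [Module R M]
    (h : moduleDepth R M = 1) (m : M) (hm : ∀ r ∈ maximalIdeal R, r • m = 0) : m = 0 := by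
  have h0 : Subsingleton (ExtGroup R 0 (ResidueField R) M) := by
    by_contra hn
    rw [not_subsingleton_iff_nontrivial] at hn
    have hle : moduleDepth R M ≤ 0 := sInf_le ⟨0, rfl, hn⟩
    rw [h] at hle
    exact absurd hle (by decide)
  obtain ⟨P0, P1, P2, P3, d3, d2, d1, e, -, -, -, he, hde, -, -, -, -, hext⟩ :=
    exists_resolution_tor (R := R) M (ResidueField R)
  let φ : ResidueField R →ₗ[R] M := Submodule.liftQ (maximalIdeal R) (LinearMap.toSpanSingleton R M m)
    (fun r hr => hm r hr)
  have h1 := hext (ModuleCat.of R M) h0 (φ ∘ₗ e) (by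
    rw [LinearMap.comp_assoc, hde.linearMap_comp_eq_zero, LinearMap.comp_zero])
  obtain ⟨z, hz⟩ := he (residue R 1)
  have h2 : φ (e z) = 0 := LinearMap.congr_fun h1 z
  rw [hz] at h2
  have h3 : φ (residue R 1) = (1 : R) • m := rfl
  rw [h3, one_smul] at h2
  exact h2

section Alg
open TensorProduct
variable {R : Type} [CommRing R]

theorem exact_comp_iff_injective {A B C D : Type} [AddCommGroup A] [Module R A] [AddCommGroup B]
    [Module R B] [AddCommGroup C] [Module R C] [AddCommGroup D] [Module R D]
    (a : A →ₗ[R] B) (c : B →ₗ[R] C) (s : C →ₗ[R] D) (hac : Function.Exact a c)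
    (hc : Function.Surjective c) :
    Function.Exact a (s ∘ₗ c) ↔ Function.Injective s := by
  constructor
  · intro h
    rw [injective_iff_map_eq_zero]
    intro z hz
    obtain ⟨b, rfl⟩ := hc z
    exact (hac b).mpr ((h b).mp hz)
  · intro h b
    rw [← hac b, LinearMap.comp_apply, map_eq_zero_iff s h]

theorem exact_rangeRestrict {A B C : Type} [AddCommGroup A] [Module R A] [AddCommGroup B]
    [Module R B] [AddCommGroup C] [Module R C] (a : A →ₗ[R] B) (b : B →ₗ[R] C)
    (h : Function.Exact a b) : Function.Exact a b.rangeRestrict := by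
  intro z
  rw [← h z]
  exact Subtype.ext_iff

theorem exact_lTensor_iff {A B C : Type} [AddCommGroup A] [Module R A] [AddCommGroup B]
    [Module R B] [AddCommGroup C] [Module R C] (X : Type) [AddCommGroup X] [Module R X]
    (a : A →ₗ[R] B) (b : B →ₗ[R] C) (h : Function.Exact a b) :
    Function.Exact (a.lTensor X) (b.lTensor X) ↔
      Function.Injective ((LinearMap.range b).subtype.lTensor X) := by
  have h1 : b.lTensor X = (LinearMap.range b).subtype.lTensor X ∘ₗ b.rangeRestrict.lTensor X := by
    rw [← LinearMap.lTensor_comp, LinearMap.subtype_comp_codRestrict]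
  rw [h1]
  exact exact_comp_iff_injective _ _ _
    (lTensor_exact X (exact_rangeRestrict a b h) b.surjective_rangeRestrict)
    (LinearMap.lTensor_surjective X b.surjective_rangeRestrict)

theorem bal {X' G X N' F N : Type} [AddCommGroup X'] [Module R X'] [AddCommGroup G] [Module R G]
    [AddCommGroup X] [Module R X] [AddCommGroup N'] [Module R N'] [AddCommGroup F] [Module R F]
    [AddCommGroup N] [Module R N] [Module.Flat R F]
    (i : X' →ₗ[R] G) (p : G →ₗ[R] X) (j : N' →ₗ[R] F) (q : F →ₗ[R] N)
    (hi : Function.Injective i) (hip : Function.Exact i p) (hp : Function.Surjective p)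
    (hjq : Function.Exact j q) (hq : Function.Surjective q)
    (h : Function.Injective (j.lTensor X)) : Function.Injective (i.rTensor N) := by
  rw [injective_iff_map_eq_zero]
  intro z hz
  obtain ⟨z, rfl⟩ := LinearMap.lTensor_surjective X' hq z
  have h1 : q.lTensor G (i.rTensor F z) = 0 := by
    rw [← hz, ← LinearMap.comp_apply, ← LinearMap.comp_apply, LinearMap.lTensor_comp_rTensor,
      LinearMap.rTensor_comp_lTensor]
  obtain ⟨w, hw⟩ := (lTensor_exact G hjq hq _).mp h1
  have h2 : p.rTensor N' w = 0 := by
    apply h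
    rw [map_zero, ← LinearMap.comp_apply, LinearMap.lTensor_comp_rTensor,
      ← LinearMap.rTensor_comp_lTensor, LinearMap.comp_apply, hw]
    exact (rTensor_exact F hip hp _).mpr ⟨z, rfl⟩
  obtain ⟨w', rfl⟩ := (rTensor_exact N' hip hp _).mp h2
  have h3 : j.lTensor X' w' = z := by
    apply Module.Flat.rTensor_preserves_injective_linearMap (M := F) i hi
    rw [← hw, ← LinearMap.comp_apply, ← LinearMap.comp_apply, LinearMap.lTensor_comp_rTensor,
      LinearMap.rTensor_comp_lTensor]
  exact (lTensor_exact X' hjq hq _).mpr ⟨w', h3⟩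

theorem bal_iff {X' G X N' F N : Type} [AddCommGroup X'] [Module R X'] [AddCommGroup G] [Module R G]
    [AddCommGroup X] [Module R X] [AddCommGroup N'] [Module R N'] [AddCommGroup F] [Module R F]
    [AddCommGroup N] [Module R N] [Module.Flat R F] [Module.Flat R G]
    (i : X' →ₗ[R] G) (p : G →ₗ[R] X) (j : N' →ₗ[R] F) (q : F →ₗ[R] N)
    (hi : Function.Injective i) (hip : Function.Exact i p) (hp : Function.Surjective p)
    (hj : Function.Injective j) (hjq : Function.Exact j q) (hq : Function.Surjective q) :
    Function.Injective (j.lTensor X) ↔ Function.Injective (i.rTensor N) := by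
  refine ⟨bal i p j q hi hip hp hjq hq, fun h => ?_⟩
  rw [LinearMap.lTensor_inj_iff_rTensor_inj]
  exact bal j q i p hj hjq hq hip hp (by rwa [LinearMap.lTensor_inj_iff_rTensor_inj])

theorem square_iff {X' G N' F : Type} [AddCommGroup X'] [Module R X'] [AddCommGroup G] [Module R G]
    [AddCommGroup N'] [Module R N'] [AddCommGroup F] [Module R F]
    [Module.Flat R F] [Module.Flat R G] (i : X' →ₗ[R] G) (j : N' →ₗ[R] F)
    (hi : Function.Injective i) (hj : Function.Injective j) :
    Function.Injective (i.rTensor N') ↔ Function.Injective (j.lTensor X') := by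
  have h1 : j.lTensor G ∘ₗ i.rTensor N' = i.rTensor F ∘ₗ j.lTensor X' := by
    rw [LinearMap.lTensor_comp_rTensor, LinearMap.rTensor_comp_lTensor]
  have h2 := Module.Flat.lTensor_preserves_injective_linearMap (M := G) j hj
  have h3 := Module.Flat.rTensor_preserves_injective_linearMap (M := F) i hi
  rw [← Function.Injective.of_comp_iff h2, ← Function.Injective.of_comp_iff h3,
    ← LinearMap.coe_comp, ← LinearMap.coe_comp, h1]

theorem tor_two_iff {G' G : Type} [AddCommGroup G] [Module R G] [AddCommGroup G'] [Module R G']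
    [Module.Flat R G] [Module.Flat R G'] (δ : G' →ₗ[R] G) (N : Type) [AddCommGroup N] [Module R N] :
    Subsingleton (TorGroup R 2 (G ⧸ LinearMap.range δ) N) ↔
      Function.Injective ((LinearMap.ker δ).subtype.lTensor N) := by
  obtain ⟨P0, P1, P2, P3, d3, d2, d1, e, hP0, hP1, -, he, hde, hd21, hd32, htor, -, -⟩ :=
    exists_resolution_tor (R := R) (G ⧸ LinearMap.range δ) N
  rw [htor, exact_lTensor_iff _ _ _ hd32]
  rw [bal_iff (LinearMap.range δ).subtype (LinearMap.range δ).mkQ (LinearMap.range d2).subtype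
    d1.rangeRestrict (Submodule.injective_subtype _) (LinearMap.exact_subtype_mkQ _)
    (Submodule.mkQ_surjective _) (Submodule.injective_subtype _) ?_ d1.surjective_rangeRestrict]
  swap
  · have := exact_rangeRestrict _ _ hd21
    intro z
    rw [this z]
    simp
  rw [square_iff (LinearMap.range δ).subtype (LinearMap.range d1).subtype
    (Submodule.injective_subtype _) (Submodule.injective_subtype _)]
  rw [bal_iff (LinearMap.ker δ).subtype δ.rangeRestrict (LinearMap.range d1).subtype e
    (Submodule.injective_subtype _) ?_ δ.surjective_rangeRestrict (Submodule.injective_subtype _) ?_ he,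
    LinearMap.lTensor_inj_iff_rTensor_inj]
  · exact exact_rangeRestrict _ _ (LinearMap.exact_subtype_ker_map δ)
  · intro z
    rw [hde z]
    simp

theorem exists_lift {Q A B : Type} [AddCommGroup A] [Module R A] [AddCommGroup B]
    [Module R B] [AddCommGroup Q] [Module R Q] [Module.Projective R Q] (d : A →ₗ[R] B)
    (f : Q →ₗ[R] B) (h : ∀ z, f z ∈ Set.range d) : ∃ g : Q →ₗ[R] A, ∀ z, d (g z) = f z := by
  obtain ⟨g, hg⟩ := Module.projective_lifting_property d.rangeRestrict
    (LinearMap.codRestrict (LinearMap.range d) f h) d.surjective_rangeRestrict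
  exact ⟨g, fun z => congrArg Subtype.val (LinearMap.congr_fun hg z)⟩

theorem ext_cond_transfer {P0 P1 P2 Q0 Q1 Q2 M N : Type}
    [AddCommGroup P0] [Module R P0] [AddCommGroup P1] [Module R P1] [AddCommGroup P2] [Module R P2]
    [AddCommGroup Q0] [Module R Q0] [AddCommGroup Q1] [Module R Q1] [AddCommGroup Q2] [Module R Q2]
    [AddCommGroup M] [Module R M] [AddCommGroup N] [Module R N]
    [Module.Projective R P0] [Module.Projective R P1] [Module.Projective R Q0]
    [Module.Projective R Q1]
    (d2 : P2 →ₗ[R] P1) (d1 : P1 →ₗ[R] P0) (e : P0 →ₗ[R] M)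
    (c2 : Q2 →ₗ[R] Q1) (c1 : Q1 →ₗ[R] Q0) (k : Q0 →ₗ[R] M)
    (hd : Function.Exact d2 d1) (hde : Function.Exact d1 e) (he : Function.Surjective e)
    (hc : Function.Exact c2 c1) (hck : Function.Exact c1 k) (hk : Function.Surjective k)
    (H : ∀ g : P1 →ₗ[R] N, g ∘ₗ d2 = 0 → ∃ h : P0 →ₗ[R] N, h ∘ₗ d1 = g) :
    ∀ g : Q1 →ₗ[R] N, g ∘ₗ c2 = 0 → ∃ h : Q0 →ₗ[R] N, h ∘ₗ c1 = g := by
  intro g hg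
  obtain ⟨u0, hu0⟩ := exists_lift e k (fun z => he _)
  obtain ⟨v0, hv0⟩ := exists_lift k e (fun z => hk _)
  obtain ⟨u1, hu1⟩ := exists_lift d1 (u0 ∘ₗ c1) (fun z => (hde _).mp (by
    rw [LinearMap.comp_apply, hu0, hck.apply_apply_eq_zero]))
  obtain ⟨v1, hv1⟩ := exists_lift c1 (v0 ∘ₗ d1) (fun z => (hck _).mp (by
    rw [LinearMap.comp_apply, hv0, hde.apply_apply_eq_zero]))
  obtain ⟨s, hs⟩ := exists_lift c1 (LinearMap.id - v0 ∘ₗ u0) (fun z => (hck _).mp (by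
    simp [hv0, hu0]))
  have hgker : ∀ z, c1 z = 0 → g z = 0 := by
    intro z hz
    obtain ⟨t, rfl⟩ := (hc z).mp hz
    exact LinearMap.congr_fun hg t
  obtain ⟨h, hh⟩ := H (g ∘ₗ v1) (by
    ext z
    apply hgker
    rw [hv1]
    simp [hd.apply_apply_eq_zero])
  refine ⟨g ∘ₗ s + h ∘ₗ u0, ?_⟩
  ext z
  have h1 : h (u0 (c1 z)) = g (v1 (u1 z)) := by
    have h2 := hu1 z
    rw [LinearMap.comp_apply] at h2
    rw [← h2]
    exact LinearMap.congr_fun hh (u1 z)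
  have h3 : g (s (c1 z) - (z - v1 (u1 z))) = 0 := by
    apply hgker
    have h4 := hu1 z
    have h5 := hv1 (u1 z)
    simp only [LinearMap.comp_apply] at h4 h5
    simp [hs, h5, h4]
  simp only [map_sub] at h3
  simp only [LinearMap.comp_apply, LinearMap.add_apply, h1]
  rw [sub_eq_zero.mp h3]
  abel

/-- `N ⊗ R^k` is `Hom(R^k, N)`. -/
noncomputable def tensorHom (N : Type) [AddCommGroup N] [Module R N] (k : ℕ) :
    TensorProduct R N (Fin k → R) ≃ₗ[R] ((Fin k → R) →ₗ[R] N) :=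
  (TensorProduct.piScalarRight R R N (Fin k)) ≪≫ₗ ((Pi.basisFun R (Fin k)).constr R)

theorem tensorHom_tmul (N : Type) [AddCommGroup N] [Module R N] (k : ℕ) (n : N) (v w : Fin k → R) :
    tensorHom N k (n ⊗ₜ[R] v) w = (dotProduct v w) • n := by
  simp [tensorHom, Module.Basis.constr_apply_fintype, dotProduct, Finset.sum_smul, smul_smul, mul_comm]

theorem tensorHom_natural (N : Type) [AddCommGroup N] [Module R N] (k l : ℕ)
    (C : Matrix (Fin k) (Fin l) R) (z : TensorProduct R N (Fin k → R)) :
    tensorHom N l (C.transpose.mulVecLin.lTensor N z) = tensorHom N k z ∘ₗ C.mulVecLin := by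
  induction z with
  | zero => simp
  | add a b ha hb => rw [map_add, map_add, ha, hb, map_add, LinearMap.add_comp]
  | tmul n v =>
    apply LinearMap.ext
    intro w
    rw [LinearMap.lTensor_tmul, tensorHom_tmul, LinearMap.comp_apply, tensorHom_tmul]
    simp only [Matrix.mulVecLin_apply]
    rw [Matrix.mulVec_transpose, Matrix.dotProduct_mulVec]

theorem ext_matrix_iff (N : Type) [AddCommGroup N] [Module R N] {n r c : ℕ}
    (A : Matrix (Fin n) (Fin r) R) (B : Matrix (Fin r) (Fin c) R) (hAB : A * B = 0) :
    (∀ g : (Fin r → R) →ₗ[R] N, g ∘ₗ B.mulVecLin = 0 →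
      ∃ h : (Fin n → R) →ₗ[R] N, h ∘ₗ A.mulVecLin = g) ↔
    Function.Exact (A.transpose.mulVecLin.lTensor N) (B.transpose.mulVecLin.lTensor N) := by
  have hAB' : A.mulVecLin ∘ₗ B.mulVecLin = 0 := by rw [← Matrix.mulVecLin_mul, hAB, Matrix.mulVecLin_zero]
  constructor
  · intro H z
    constructor
    · intro hz
      obtain ⟨h, hh⟩ := H (tensorHom N r z) (by rw [← tensorHom_natural, hz, map_zero])
      refine ⟨(tensorHom N n).symm h, ?_⟩
      apply (tensorHom N r).injective
      rw [tensorHom_natural, LinearEquiv.apply_symm_apply, hh]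
    · rintro ⟨w, rfl⟩
      apply (tensorHom N c).injective
      rw [tensorHom_natural, tensorHom_natural, LinearMap.comp_assoc, hAB', LinearMap.comp_zero, map_zero]
  · intro H g hg
    obtain ⟨w, hw⟩ := (H ((tensorHom N r).symm g)).mp (by
      apply (tensorHom N c).injective
      rw [tensorHom_natural, LinearEquiv.apply_symm_apply, hg, map_zero])
    refine ⟨tensorHom N n w, ?_⟩
    rw [← tensorHom_natural, hw, LinearEquiv.apply_symm_apply]

theorem ker_transpose_iff_dual (M N : Type) [AddCommGroup M] [Module R M] [AddCommGroup N]
    [Module R N] {a b : ℕ} (D : Matrix (Fin a) (Fin b) R) (π : (Fin a → R) →ₗ[R] M)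
    (hπ : Function.Surjective π) (hex : Function.Exact D.mulVecLin π) :
    Function.Injective ((LinearMap.ker D.transpose.mulVecLin).subtype.lTensor N) ↔
      Function.Injective (dualTensorHom R M N) := by
  let θ : Module.Dual R M →ₗ[R] (Fin a → R) :=
    { toFun := fun φ i => φ (π (Pi.single i 1))
      map_add' := by intros; ext; simp
      map_smul' := by intros; ext; simp }
  have hθdot : ∀ (φ : Module.Dual R M) (w : Fin a → R), dotProduct (θ φ) w = φ (π w) := by
    intro φ w
    have : w = ∑ i, w i • Pi.single i (1 : R) := by
      ext j; simp [Finset.sum_apply, Pi.single_apply]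
    conv_rhs => rw [this]
    simp [θ, dotProduct, mul_comm]
  have hθinj : Function.Injective θ := by
    rw [injective_iff_map_eq_zero]
    intro φ h
    ext m
    obtain ⟨w, rfl⟩ := hπ m
    rw [← hθdot, h]; simp
  have hker : ∀ v : Fin a → R, v ∈ LinearMap.ker D.transpose.mulVecLin ↔ ∀ u, dotProduct v (D.mulVec u) = 0 := by
    intro v
    rw [LinearMap.mem_ker, Matrix.mulVecLin_apply, Matrix.mulVec_transpose]
    simp only [Matrix.dotProduct_mulVec]
    exact dotProduct_eq_zero_iff.symm
  have hrange : LinearMap.range θ = LinearMap.ker D.transpose.mulVecLin := by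
    ext v
    rw [hker]
    constructor
    · rintro ⟨φ, rfl⟩ u
      rw [hθdot]
      have := hex.apply_apply_eq_zero u
      rw [Matrix.mulVecLin_apply] at this
      rw [this, map_zero]
    · intro hv
      let lv : (Fin a → R) →ₗ[R] R := dotProductBilin R R v
      have hle : LinearMap.ker π ≤ LinearMap.ker lv := by
        intro z hz
        obtain ⟨u, rfl⟩ := (hex z).mp hz
        exact hv u
      let φ : Module.Dual R M := (Submodule.liftQ _ lv hle) ∘ₗ (π.quotKerEquivOfSurjective hπ).symm.toLinearMap
      have hφ : ∀ w, φ (π w) = dotProduct v w := by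
        intro w
        have : (π.quotKerEquivOfSurjective hπ).symm (π w) = Submodule.Quotient.mk w := by
          rw [LinearEquiv.symm_apply_eq]; rfl
        simp only [φ, LinearMap.comp_apply, LinearEquiv.coe_coe, this]
        rfl
      refine ⟨φ, ?_⟩
      ext i
      change φ (π (Pi.single i 1)) = v i
      rw [hφ]; simp
  rw [← hrange]
  have h1 : θ.lTensor N = (LinearMap.range θ).subtype.lTensor N ∘ₗ θ.rangeRestrict.lTensor N := by
    rw [← LinearMap.lTensor_comp, LinearMap.subtype_comp_codRestrict]
  let E := LinearEquiv.ofInjective θ hθinj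
  have h1 : θ.lTensor N = (LinearMap.range θ).subtype.lTensor N ∘ₗ (E.lTensor N).toLinearMap := by
    rw [LinearEquiv.coe_lTensor, ← LinearMap.lTensor_comp]; rfl
  have h2 : Function.Injective ((LinearMap.range θ).subtype.lTensor N) ↔ Function.Injective (θ.lTensor N) := by
    rw [h1]
    exact ((EquivLike.injective_comp (E.lTensor N) _)).symm
  rw [h2]
  have h3 : ∀ z, tensorHom N a (θ.lTensor N z) = dualTensorHom R M N (TensorProduct.comm R _ _ z) ∘ₗ π := by
    intro z
    induction z with
    | zero => simp
    | add a b ha hb => simp only [map_add, ha, hb, LinearMap.add_comp]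
    | tmul n φ =>
      apply LinearMap.ext
      intro w
      rw [LinearMap.lTensor_tmul, tensorHom_tmul, hθdot]
      simp
  rw [injective_iff_map_eq_zero, injective_iff_map_eq_zero]
  constructor
  · intro H z hz
    have := H ((TensorProduct.comm R _ _).symm z) (by
      apply (tensorHom N a).injective
      rw [h3, LinearEquiv.apply_symm_apply, hz, LinearMap.zero_comp, map_zero])
    simpa using this
  · intro H z hz
    have h4 := h3 z
    rw [hz, map_zero] at h4
    have := H (TensorProduct.comm R _ _ z) (by
      ext m
      obtain ⟨w, rfl⟩ := hπ m
      exact (LinearMap.congr_fun h4 w).symm)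
    simpa using this
end Alg

/-- Let `R = S/(f)` be a reduced local hypersurface of dimension `1` and `M`, `N` maximal
Cohen-Macaulay `R`-modules.  Given a minimal free presentation
`R^b --D--> R^a --π--> M → 0` of `M`, the Auslander transpose `M^t` is the cokernel of the
transposed map `Dᵀ : R^a → R^b`.  Then `Ext_R^1(M, N) = 0` iff `Tor_2^R(M^t, N) = 0`. -/
theorem ext_one_vanishes_iff_tor_two_transpose_vanishes
    (S : Type) [CommRing S] [IsLocalRing S] (hS : IsRegularLocalTwoDim S)
    (f : S) (hf0 : f ≠ 0) [IsLocalRing (S ⧸ Ideal.span {f})]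
    (hred : IsReduced (S ⧸ Ideal.span {f}))
    (hdim : ringKrullDim (S ⧸ Ideal.span {f}) = 1)
    (M N : Type) [AddCommGroup M] [Module (S ⧸ Ideal.span {f}) M]
    [AddCommGroup N] [Module (S ⧸ Ideal.span {f}) N]
    (hM : IsMCM1 (S ⧸ Ideal.span {f}) M) (hN : IsMCM1 (S ⧸ Ideal.span {f}) N)
    -- a minimal free presentation of `M` given by a matrix `D`
    (a b : ℕ) (D : Matrix (Fin a) (Fin b) (S ⧸ Ideal.span {f}))
    (π : (Fin a → (S ⧸ Ideal.span {f})) →ₗ[S ⧸ Ideal.span {f}] M)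
    (hπ : Function.Surjective π)
    (hexact : Function.Exact D.mulVecLin π)
    (hmin₀ : LinearMap.range D.mulVecLin ≤
      (IsLocalRing.maximalIdeal (S ⧸ Ideal.span {f})) • ⊤)
    (hmin₁ : LinearMap.ker D.mulVecLin ≤
      (IsLocalRing.maximalIdeal (S ⧸ Ideal.span {f})) • ⊤) :
    Subsingleton (ExtGroup (S ⧸ Ideal.span {f}) 1 M N) ↔
      Subsingleton (TorGroup (S ⧸ Ideal.span {f}) 2
        ((Fin b → (S ⧸ Ideal.span {f})) ⧸ LinearMap.range (Matrix.mulVecLin D.transpose)) N) := by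
  obtain ⟨hnoeth, hdim2, x, y, hxy⟩ := hS
  have hMfin := hM.1
  obtain ⟨n, r, A, B, p, hp, hAp, hBA, hBAt, hABt⟩ :=
    exists_factorization hdim2 x y hxy f hf0 M (socle_of_depth M hM.2)
  rw [tor_two_iff D.transpose.mulVecLin N, ker_transpose_iff_dual M N D π hπ hexact,
    ← ker_transpose_iff_dual M N A p hp hAp]
  have hk : LinearMap.ker A.transpose.mulVecLin = LinearMap.range B.transpose.mulVecLin :=
    hBAt.linearMap_ker_eq
  rw [hk, ← exact_lTensor_iff N _ _ hABt, ← ext_matrix_iff N A B ?_]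
  swap
  · have h := hBA.linearMap_comp_eq_zero
    rw [← Matrix.mulVecLin_mul] at h
    exact Matrix.toLin'.injective (by rw [map_zero]; exact h)
  obtain ⟨P0, P1, P2, P3, d3, d2, d1, e, hP0, hP1, -, he, hde, hd21, -, -, hext, -⟩ :=
    exists_resolution_tor (R := S ⧸ Ideal.span {f}) M M
  rw [hext (ModuleCat.of _ N)]
  exact ⟨ext_cond_transfer d2 d1 e B.mulVecLin A.mulVecLin p hd21 hde he hBA hAp hp,
    ext_cond_transfer B.mulVecLin A.mulVecLin p d2 d1 e hBA hAp hp hd21 hde he⟩
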